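/- Theorem 1 (per-rack access bound). Let C be an (n,k,l) MDS linear array code over a finite field F and let P be an hl × nl matrix over F whose rows lie in the dual code C^⊥, where 1 ≤ h ≤ min{u, s̄u − v}, such that: (i) rank [P_{j'_1},…,P_{j'_h}] = hl for distinct failed nodes j'_b = e'u + g'_b in a host rack e'; (ii) there is a set R ⊆ {0,…,n̄−1}∖{e'} of helper racks with |R| = d̄ such that P̄_e = 0 for every e ∉ R ∪ {e'}; and (iii) s̄ · rank P̄_e = hl for every e ∈ R. Then for every e ∈ R, the number of nonzero columns of P̄_e satisfies s̄(u−v) · acs(P̄_e) ≥ h·u·l. -/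

import Mathlib

/-- A vector supported on `m` nodes and orthogonal to a code of dimension `m * l` any of whose words
vanishing on `m` nodes is zero, is itself zero. -/
theorem eq_zero_of_orthogonal_of_support {F ι : Type*} [Field F] [Fintype ι] [DecidableEq ι]
    {l m : ℕ} (C : Submodule F (ι → Fin l → F)) (hdim : Module.finrank F C = m * l)
    (hMDS : ∀ c ∈ C, ∀ S : Finset ι, S.card = m → (∀ j ∈ S, c j = 0) → c = 0)
    (w : ι → Fin l → F) (hw : ∀ c ∈ C, ∑ j, ∑ i, w j i * c j i = 0)
    (S : Finset ι) (hS : S.card = m) (hsupp : ∀ j ∉ S, w j = 0) : w = 0 := by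
  let restr : C →ₗ[F] (S → Fin l → F) := LinearMap.funLeft F (Fin l → F) Subtype.val ∘ₗ C.subtype
  have hinj : Function.Injective restr := by
    rw [← LinearMap.ker_eq_bot, LinearMap.ker_eq_bot']
    intro c hc
    refine Subtype.ext (hMDS c c.2 S hS fun j hj => ?_)
    exact congrFun hc ⟨j, hj⟩
  have hsurj : Function.Surjective restr := by
    refine (LinearMap.injective_iff_surjective_of_finrank_eq_finrank ?_).1 hinj
    rw [hdim, Module.finrank_pi_fintype]
    simp [hS]
  funext j i
  by_cases hj : j ∈ S
  · obtain ⟨c, hc⟩ := hsurj (Pi.single ⟨j, hj⟩ (Pi.single i 1))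
    have hval : ∀ a (ha : a ∈ S), (c : ι → Fin l → F) a
        = Pi.single (M := fun _ : S => Fin l → F) ⟨j, hj⟩ (Pi.single i 1) ⟨a, ha⟩ :=
      fun a ha => congrFun hc ⟨a, ha⟩
    have h0 := hw c c.2
    rw [Finset.sum_eq_single j, Finset.sum_eq_single i] at h0
    · simpa [hval j hj] using h0
    · intro b _ hb
      simp [hval j hj, hb]
    · simp
    · intro b _ hb
      by_cases hbS : b ∈ S
      · simp [hval b hbS, hb]
      · simp [hsupp b hbS]
    · simp
  · simp [hsupp j hj]

theorem Matrix.rank_eq_finrank_range_vecMulLinear {F m n : Type*} [Field F] [Fintype m] [Fintype n]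
    (M : Matrix m n F) : M.rank = Module.finrank F (LinearMap.range M.vecMulLinear) := by
  rw [Matrix.rank_eq_finrank_span_row, range_vecMulLinear]

theorem Matrix.vecMulLinear_injective_of_rank {F m n : Type*} [Field F] [Fintype m] [Fintype n]
    (M : Matrix m n F) (hM : M.rank = Fintype.card m) : Function.Injective M.vecMulLinear := by
  have hsum := M.vecMulLinear.finrank_range_add_finrank_ker
  rw [← M.rank_eq_finrank_range_vecMulLinear, hM, Module.finrank_fintype_fun_eq_card] at hsum
  rw [← LinearMap.ker_eq_bot, ← Submodule.finrank_eq_zero]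
  omega

/-- Codimension of an intersection of kernels is at most the sum of the ranks. -/
theorem finrank_le_finrank_iInf_ker_add_sum {F V W ι : Type*} [Field F] [AddCommGroup V]
    [Module F V] [FiniteDimensional F V] [AddCommGroup W] [Module F W]
    (f : ι → V →ₗ[F] W) (A : Finset ι) :
    Module.finrank F V ≤ Module.finrank F (⨅ a ∈ A, LinearMap.ker (f a) : Submodule F V)
      + ∑ a ∈ A, Module.finrank F (LinearMap.range (f a)) := by
  classical
  induction A using Finset.induction_on with
  | empty =>
    have htop : (⨅ a ∈ (∅ : Finset ι), LinearMap.ker (f a)) = ⊤ := by simp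
    rw [htop, finrank_top]
    simp
  | insert a A ha ih =>
    rw [Finset.iInf_insert, Finset.sum_insert ha]
    have h1 := Submodule.finrank_sup_add_finrank_inf_eq (LinearMap.ker (f a))
      (⨅ b ∈ A, LinearMap.ker (f b))
    have h2 := (f a).finrank_range_add_finrank_ker
    have h3 := Submodule.finrank_le (LinearMap.ker (f a) ⊔ ⨅ b ∈ A, LinearMap.ker (f b))
    omega

/-- Averaging over cyclic windows: if `a` sums to at least `β` on every set of `m` elements of
`Fin u`, then `u * β ≤ m * ∑ a`. -/
theorem mul_le_mul_sum_of_forall_card_eq {u m β : ℕ} (hm : m ≤ u) (a : Fin u → ℕ)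
    (ha : ∀ G : Finset (Fin u), G.card = m → β ≤ ∑ g ∈ G, a g) : u * β ≤ m * ∑ g, a g := by
  rcases Nat.eq_zero_or_pos u with rfl | hu
  · simp
  have : NeZero u := ⟨hu.ne'⟩
  have hwindow : ∀ t : Fin u, β ≤ ∑ i : Fin m, a (t + Fin.castLE hm i) := by
    intro t
    have hinj : Function.Injective fun i : Fin m => t + Fin.castLE hm i :=
      (add_right_injective t).comp (Fin.castLE_injective hm)
    have := ha (Finset.univ.map ⟨_, hinj⟩) (by simp)
    simpa using this
  calc u * β = ∑ _t : Fin u, β := by simp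
    _ ≤ ∑ t : Fin u, ∑ i : Fin m, a (t + Fin.castLE hm i) :=
      Finset.sum_le_sum fun t _ => hwindow t
    _ = ∑ i : Fin m, ∑ t : Fin u, a (t + Fin.castLE hm i) := Finset.sum_comm
    _ = ∑ _i : Fin m, ∑ g, a g :=
      Finset.sum_congr rfl fun i _ => Equiv.sum_comp (Equiv.addRight (Fin.castLE hm i)) a
    _ = m * ∑ g, a g := by simp

/-- **Theorem 1 (per-rack access bound).**
`C` is an `(n,k,l)` MDS linear array code over `F` (nodes indexed by
`(e,g) : Fin nb × Fin u`, i.e. node `j = e·u+g`), `P` is an `hl × nl` matrix whose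
rows lie in the dual code `C^⊥`, with (i) the block `[P_{j'_1},…,P_{j'_h}]` of the
failed nodes of rank `hl`, (ii) `P̄_e = 0` for every rack `e ∉ R ∪ {e'}`, and
(iii) `s̄ · rank P̄_e = hl` for every helper rack `e ∈ R`.  Then for every `e ∈ R`
the number `acs(P̄_e)` of nonzero columns of `P̄_e` satisfies
`s̄(u−v) · acs(P̄_e) ≥ h·u·l`. -/
theorem per_rack_access_bound
    (F : Type*) [Field F] [Fintype F] [DecidableEq F]
    (u nb kb v db sb l h : ℕ)
    (hu : 1 < u) (hkb : 1 ≤ kb) (hnb : kb < nb) (hv : v < u)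
    (hdb1 : kb ≤ db) (hdb2 : db ≤ nb - 1) (hsb : sb = db - kb + 1)
    (hh1 : 1 ≤ h) (hh2 : h ≤ u) (hh3 : h + v ≤ sb * u)
    (C : Submodule F ((Fin nb × Fin u) → Fin l → F))
    (hdim : Module.finrank F C = (kb * u + v) * l)
    (hMDS : ∀ c ∈ C, ∀ S : Finset (Fin nb × Fin u), S.card = kb * u + v →
      (∀ j ∈ S, c j = 0) → c = 0)
    (P : Matrix (Fin (h * l)) ((Fin nb × Fin u) × Fin l) F)
    (hdual : ∀ ρ : Fin (h * l), ∀ c ∈ C,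
      ∑ j : Fin nb × Fin u, ∑ i : Fin l, P ρ (j, i) * c j i = 0)
    (e' : Fin nb) (g' : Fin h → Fin u) (hg' : Function.Injective g')
    (hrank1 : (Matrix.of fun ρ (bi : Fin h × Fin l) =>
      P ρ ((e', g' bi.1), bi.2)).rank = h * l)
    (R : Finset (Fin nb)) (hR : R.card = db) (he'R : e' ∉ R)
    (hzero : ∀ e : Fin nb, e ∉ R → e ≠ e' → ∀ ρ g i, P ρ ((e, g), i) = 0)
    (hrankR : ∀ e ∈ R,
      sb * (Matrix.of fun ρ (gi : Fin u × Fin l) =>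
        P ρ ((e, gi.1), gi.2)).rank = h * l) :
    ∀ e ∈ R,
      h * (u * l) ≤ sb * (u - v) *
        (Finset.univ.filter (fun gi : Fin u × Fin l =>
          ∃ ρ, P ρ ((e, gi.1), gi.2) ≠ 0)).card := by
  classical
  intro e he
  let M : Fin nb → Matrix (Fin (h * l)) (Fin u × Fin l) F :=
    fun a => Matrix.of fun ρ gi => P ρ ((a, gi.1), gi.2)
  have hPinj : ∀ x, P.vecMulLinear x = 0 → x = 0 := by
    intro x hx
    refine (injective_iff_map_eq_zero _).1
      (Matrix.vecMulLinear_injective_of_rank _ (hrank1.trans (Fintype.card_fin _).symm)) x ?_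
    funext bi
    exact congrFun hx ((e', g' bi.1), bi.2)
  have hPorth : ∀ x, ∀ c ∈ C,
      ∑ j : Fin nb × Fin u, ∑ i : Fin l, P.vecMulLinear x (j, i) * c j i = 0 := by
    intro x c hc
    have hexp : ∀ j i, P.vecMulLinear x (j, i) * c j i = ∑ ρ, x ρ * (P ρ (j, i) * c j i) := by
      intro j i
      simp [Matrix.vecMul, dotProduct, Finset.sum_mul, mul_assoc]
    simp_rw [hexp]
    rw [Finset.sum_congr rfl fun j _ => Finset.sum_comm, Finset.sum_comm]
    simp_rw [← Finset.mul_sum]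
    simp [hdual _ c hc]
  obtain ⟨A, hA, hAcard⟩ : ∃ A ⊆ R.erase e, A.card = sb - 1 := by
    apply Finset.exists_subset_card_eq
    rw [Finset.card_erase_of_mem he]
    omega
  have hAR : A ⊆ R := hA.trans (Finset.erase_subset _ _)
  have heA : e ∉ A := fun hmem => Finset.notMem_erase e R (hA hmem)
  let K : Submodule F (Fin (h * l) → F) := ⨅ a ∈ A, LinearMap.ker (M a).vecMulLinear
  have hK : h * l ≤ sb * Module.finrank F K := by
    have hle := finrank_le_finrank_iInf_ker_add_sum (fun a => (M a).vecMulLinear) A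
    rw [Module.finrank_fin_fun] at hle
    have hsum : sb * ∑ a ∈ A, Module.finrank F (LinearMap.range (M a).vecMulLinear)
        = (sb - 1) * (h * l) := by
      have hterm : ∀ a ∈ A,
          sb * Module.finrank F (LinearMap.range (M a).vecMulLinear) = h * l := by
        intro a ha
        rw [← Matrix.rank_eq_finrank_range_vecMulLinear]
        exact hrankR a (hAR ha)
      rw [Finset.mul_sum, Finset.sum_congr rfl hterm, Finset.sum_const, hAcard, smul_eq_mul]
    have hmul := Nat.mul_le_mul_left sb hle
    rw [mul_add, hsum] at hmul
    obtain ⟨t, rfl⟩ : ∃ t, sb = t + 1 := ⟨_, hsb⟩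
    rw [Nat.add_sub_cancel, Nat.add_mul t 1 (h * l)] at hmul
    change _ ≤ (t + 1) * Module.finrank F K + _ at hmul
    omega
  have hwindow : ∀ G : Finset (Fin u), G.card = u - v → Module.finrank F K ≤
      ∑ g ∈ G, (Finset.univ.filter fun i : Fin l => ∃ ρ, P ρ ((e, g), i) ≠ 0).card := by
    intro G hG
    let T : Finset (Σ _ : Fin u, Fin l) :=
      G.sigma fun g => Finset.univ.filter fun i : Fin l => ∃ ρ, P ρ ((e, g), i) ≠ 0
    let f : K →ₗ[F] (T → F) :=
      LinearMap.funLeft F F (fun t : T => ((e, t.1.1), t.1.2)) ∘ₗ P.vecMulLinear ∘ₗ K.subtype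
    have hf : Function.Injective f := by
      refine (injective_iff_map_eq_zero f).2 fun x hx => Subtype.ext (hPinj x ?_)
      have hcol : ∀ g ∈ G, ∀ i, P.vecMulLinear (x : Fin (h * l) → F) ((e, g), i) = 0 := by
        intro g hg i
        by_cases hne : ∃ ρ, P ρ ((e, g), i) ≠ 0
        · exact congrFun hx ⟨⟨g, i⟩, by simpa [T] using ⟨hg, hne⟩⟩
        · push Not at hne
          simp [Matrix.vecMul, dotProduct, hne]
      let S : Finset (Fin nb × Fin u) :=
        (insert e' (R \ A)) ×ˢ Finset.univ \ ({e} ×ˢ G)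
      have hScard : S.card = kb * u + v := by
        rw [Finset.card_sdiff_of_subset, Finset.card_product, Finset.card_product,
          Finset.card_insert_of_notMem (by simp [he'R]), Finset.card_sdiff_of_subset hAR, hR,
          hAcard, hG, show db - (sb - 1) = kb by omega, Finset.card_univ, Fintype.card_fin,
          Finset.card_singleton, Nat.add_mul]
        · omega
        · refine Finset.product_subset_product ?_ (Finset.subset_univ _)
          simp [he, heA]
      have hzero' := eq_zero_of_orthogonal_of_support C hdim hMDS
        (fun j i => P.vecMulLinear (x : Fin (h * l) → F) (j, i)) (hPorth x) S hScard ?_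
      · funext ji
        exact congrFun (congrFun hzero' ji.1) ji.2
      · rintro ⟨a, g⟩ hj
        funext i
        by_cases haA : a ∈ A
        · have hxK : (x : Fin (h * l) → F) ∈ LinearMap.ker (M a).vecMulLinear :=
            (Submodule.mem_iInf _).1 ((Submodule.mem_iInf _).1 x.2 a) haA
          exact congrFun hxK (g, i)
        by_cases hae' : a = e' ∨ a ∈ R
        · have hag : a = e ∧ g ∈ G := by
            by_contra hcon
            apply hj
            simp only [S, Finset.mem_sdiff, Finset.mem_product, Finset.mem_insert,
              Finset.mem_univ, Finset.mem_singleton]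
            tauto
          obtain ⟨rfl, hg⟩ := hag
          exact hcol g hg i
        · push Not at hae'
          simp [Matrix.vecMul, dotProduct, hzero a hae'.2 hae'.1]
    have hle := LinearMap.finrank_le_finrank_of_injective hf
    rw [Module.finrank_fintype_fun_eq_card, Fintype.card_coe, Finset.card_sigma] at hle
    exact hle
  have havg := mul_le_mul_sum_of_forall_card_eq (Nat.sub_le u v) _ hwindow
  have hcount : (Finset.univ.filter fun gi : Fin u × Fin l =>
        ∃ ρ, P ρ ((e, gi.1), gi.2) ≠ 0).card
      = ∑ g, (Finset.univ.filter fun i : Fin l => ∃ ρ, P ρ ((e, g), i) ≠ 0).card := by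
    simp only [Finset.card_filter, Fintype.sum_prod_type]
  rw [hcount]
  calc h * (u * l) = u * (h * l) := by ring
    _ ≤ u * (sb * Module.finrank F K) := Nat.mul_le_mul_left u hK
    _ = sb * (u * Module.finrank F K) := by ring
    _ ≤ _ := by
      rw [mul_assoc sb]
      exact Nat.mul_le_mul_left sb havg
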